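/- arXiv:math/0407291 — 6 statements merged into one kernel-verified Lean document; each statement's English description precedes it below -/
import Mathlib

section
/- Lemma 5.4. For every k ∈ {1,…,n}, ∏_{j∈{1,…,n}\{k}} θ_j = Σ_σ sgn(σ) ∏_{j∈{1,…,n}\{k}} e(σ(j), k), where the sum runs over all permutations σ of the set {1,…,n}\{k}, sgn(σ) = (−1)^{ℓ(σ)} is the sign of σ, and each product ∏ is taken in increasing order of the index j. -/
section MarkedRelations

variable {α B : Type*} [DecidableEq α] [Ring B]

/-- The relations satisfied by the products `ξ_a e(a,b)`, where the `ξ_a` are anticommuting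
variables that commute with the generators `e(a,b)`. -/
structure MarkedRelations (x : α → α → B) : Prop where
  comm : ∀ a b c d, a ≠ b → c ≠ d → a ≠ c → a ≠ d → b ≠ c → b ≠ d →
    x a b * x c d = x c d * x a b
  tri : ∀ a b c, a ≠ b → b ≠ c → c ≠ a → x a b * x c b = x c b * x a c + x c a * x a b
  sq : ∀ a b, a ≠ b → x a b * x b a = 0

/-- The Dunkl element of the vertex `a` relative to the vertex set `V`. -/
def dunkl (x : α → α → B) (V : Finset α) (a : α) : B := ∑ d ∈ V.erase a, x a d

/-- The ordered product of the Dunkl elements along a list. -/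
def dunklProd (x : α → α → B) (V : Finset α) (L : List α) : B := (L.map (dunkl x V)).prod

variable {x : α → α → B}

theorem dunklProd_cons (V : Finset α) (c : α) (L : List α) :
    dunklProd x V (c :: L) = dunkl x V c * dunklProd x V L := by
  simp [dunklProd]

theorem toFinset_erase {L : List α} (hL : L.Nodup) (u : α) :
    (L.erase u).toFinset = L.toFinset.erase u := by
  ext v; simp [hL.mem_erase_iff]

theorem dunkl_insert {V : Finset α} {a b : α} (hb : b ∉ V) (hab : a ≠ b) :
    dunkl x (insert b V) a = x a b + dunkl x V a := by
  unfold dunkl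
  rw [Finset.erase_insert_of_ne hab.symm, Finset.sum_insert (by simp [hb])]

theorem dunkl_eq_erase {V : Finset α} {a u : α} (hu : u ∈ V) (hau : a ≠ u) :
    dunkl x V a = x a u + dunkl x (V.erase u) a := by
  conv_lhs => rw [← Finset.insert_erase hu]
  exact dunkl_insert (by simp) hau

theorem MarkedRelations.dunkl_comm (h : MarkedRelations x) {V : Finset α} {c u b : α}
    (hu : u ∉ V) (hb : b ∉ V) (hcu : c ≠ u) (hcb : c ≠ b) (hub : u ≠ b) :
    dunkl x V c * x u b = x u b * dunkl x V c := by
  unfold dunkl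
  rw [Finset.sum_mul, Finset.mul_sum]
  refine Finset.sum_congr rfl fun d hd => ?_
  rw [Finset.mem_erase] at hd
  exact h.comm _ _ _ _ hd.1.symm hub hcu hcb (by grind) (by grind)

/-- Moving `θ_c` past `e(u,b)`. -/
theorem MarkedRelations.dunkl_mul (h : MarkedRelations x) {W : Finset α} {c u b : α}
    (hu : u ∈ W) (hc : c ∉ W) (hb : b ∉ W) (hcb : c ≠ b) :
    dunkl x (insert b (insert c W)) c * x u b =
      x u b * dunkl x (insert b (insert c (W.erase u))) c + x c b * (x u b - x u c) := by
  have hcu : c ≠ u := by grind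
  have hub : u ≠ b := by grind
  have self : ∀ W : Finset α, c ∉ W → dunkl x (insert c W) c = dunkl x W c := by
    intro W hW
    simp [dunkl, hW]
  rw [dunkl_insert (by grind) hcb, dunkl_insert (by grind) hcb, self _ hc, self _ (by grind),
    dunkl_eq_erase hu hcu]
  have h1 := h.dunkl_comm (V := W.erase u) (by simp) (by grind) hcu hcb hub
  have h2 := h.tri u b c hub hcb.symm hcu
  rw [add_mul, add_mul, h1, mul_add, h2]
  noncomm_ring

/-- Effect on a product of Dunkl elements of adjoining a vertex `b`. -/
theorem MarkedRelations.dunklProd_insert (h : MarkedRelations x) (m : ℕ) :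
    ∀ (L : List α) (V : Finset α) (b : α), L.length = m → L.Nodup → L.toFinset ⊆ V → b ∉ V →
      dunklProd x (insert b V) L = dunklProd x V L +
        ∑ u ∈ L.toFinset, x u b * dunklProd x (insert b (V.erase u)) (L.erase u) := by
  induction m using Nat.strong_induction_on with
  | _ m ih =>
  intro L V b hlen hnd hLV hb
  match L, hlen, hnd, hLV with
  | [], _, _, _ => simp [dunklProd]
  | c :: L, hlen, hnd, hLV =>
    obtain ⟨hcL, hnd⟩ := List.nodup_cons.1 hnd
    have hcV : c ∈ V := hLV (by simp)
    obtain ⟨W, hcW, rfl⟩ : ∃ W, c ∉ W ∧ V = insert c W :=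
      ⟨V.erase c, by simp, (Finset.insert_erase hcV).symm⟩
    have hLW : L.toFinset ⊆ W := by
      intro a ha
      have hac : a ≠ c := by rintro rfl; exact hcL (by simpa using ha)
      have := hLV (show a ∈ (c :: L).toFinset by simp at ha; simp [ha])
      grind
    have hbW : b ∉ W := by grind
    have hcb : c ≠ b := by grind
    have hL : L.length < m := by simp at hlen; omega
    have ih1 := ih _ hL L (insert c W) b rfl hnd (hLW.trans (Finset.subset_insert _ _)) hb
    have ih2 := ih _ hL L W c rfl hnd hLW hcW
    have ih3 := ih _ hL L W b rfl hnd hLW hbW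
    have key : ∀ p q : α, p ≠ q → p ∉ W → q ∉ W → ∀ u ∈ L.toFinset,
        dunklProd x (insert p (insert q (W.erase u))) (L.erase u) =
        dunklProd x (insert q (W.erase u)) (L.erase u) + ∑ v ∈ L.toFinset.erase u,
          x v p * dunklProd x (insert p (insert q ((W.erase u).erase v)))
            ((L.erase u).erase v) := by
      intro p q hpq hp hq u hu
      have hu' : u ∈ L := by simpa using hu
      have h1 : (L.erase u).length < m := (List.length_erase_le).trans_lt hL
      have hs : (L.erase u).toFinset ⊆ W.erase u := by
        rw [toFinset_erase hnd]; exact Finset.erase_subset_erase _ hLW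
      rw [ih _ h1 (L.erase u) (insert q (W.erase u)) p rfl (hnd.erase u)
        (hs.trans (Finset.subset_insert _ _)) (by grind), toFinset_erase hnd]
      congr 1
      refine Finset.sum_congr rfl fun v hv => ?_
      rw [Finset.erase_insert_of_ne (a := q) (b := v) (by grind)]
    have ebc : ∀ u ∈ L.toFinset, (insert c W).erase u = insert c (W.erase u) := by
      intro u hu
      exact Finset.erase_insert_of_ne (by grind)
    -- the double sums cancel in pairs
    have swap : ∑ u ∈ L.toFinset, x u b * (∑ v ∈ L.toFinset.erase u,
          x v c * dunklProd x (insert c (insert b ((W.erase u).erase v))) ((L.erase u).erase v)) =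
        ∑ u ∈ L.toFinset, x u c * (∑ v ∈ L.toFinset.erase u,
          x v b * dunklProd x (insert b (insert c ((W.erase u).erase v)))
            ((L.erase u).erase v)) := by
      simp only [Finset.mul_sum]
      rw [Finset.sum_comm' (t' := L.toFinset) (s' := fun v => L.toFinset.erase v) (by grind)]
      refine Finset.sum_congr rfl fun v hv => Finset.sum_congr rfl fun u hu => ?_
      rw [← mul_assoc, ← mul_assoc, Finset.insert_comm c b, Finset.erase_right_comm,
        List.erase_comm, h.comm u b v c (by grind) (by grind) (by grind) (by grind) (by grind)
          (by grind)]
    have brace : dunklProd x (insert c W) L - dunklProd x (insert b W) L +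
        ∑ u ∈ L.toFinset, (x u b - x u c) *
          dunklProd x (insert b (insert c (W.erase u))) (L.erase u) = 0 := by
      have e1 : ∑ u ∈ L.toFinset, x u b *
            dunklProd x (insert b (insert c (W.erase u))) (L.erase u) =
          ∑ u ∈ L.toFinset, x u b * dunklProd x (insert b (W.erase u)) (L.erase u) +
          ∑ u ∈ L.toFinset, x u b * (∑ v ∈ L.toFinset.erase u,
          x v c * dunklProd x (insert c (insert b ((W.erase u).erase v)))
            ((L.erase u).erase v)) := by
        rw [← Finset.sum_add_distrib]
        refine Finset.sum_congr rfl fun u hu => ?_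
        rw [Finset.insert_comm b c, key c b hcb hcW hbW u hu, mul_add]
      have e2 : ∑ u ∈ L.toFinset, x u c *
            dunklProd x (insert b (insert c (W.erase u))) (L.erase u) =
          ∑ u ∈ L.toFinset, x u c * dunklProd x (insert c (W.erase u)) (L.erase u) +
          ∑ u ∈ L.toFinset, x u c * (∑ v ∈ L.toFinset.erase u,
          x v b * dunklProd x (insert b (insert c ((W.erase u).erase v)))
            ((L.erase u).erase v)) := by
        rw [← Finset.sum_add_distrib]
        refine Finset.sum_congr rfl fun u hu => ?_
        rw [key b c hcb.symm hbW hcW u hu, mul_add]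
      simp only [sub_mul, Finset.sum_sub_distrib]
      rw [e1, e2, swap, ih2, ih3]
      abel
    rw [List.toFinset_cons, Finset.sum_insert (by simpa using hcL), List.erase_cons_head,
      Finset.erase_insert hcW]
    have e3 : ∑ u ∈ L.toFinset, x u b *
          dunklProd x (insert b ((insert c W).erase u)) ((c :: L).erase u) =
        dunkl x (insert b (insert c W)) c * ∑ u ∈ L.toFinset, x u b *
          dunklProd x (insert b (insert c (W.erase u))) (L.erase u) -
        x c b * ∑ u ∈ L.toFinset, (x u b - x u c) *
          dunklProd x (insert b (insert c (W.erase u))) (L.erase u) := by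
      rw [Finset.mul_sum, Finset.mul_sum, ← Finset.sum_sub_distrib]
      refine Finset.sum_congr rfl fun u hu => ?_
      have huc : c ≠ u := by rintro rfl; exact hcW (hLW hu)
      rw [ebc u hu, List.erase_cons_tail (by simpa using huc), dunklProd_cons, ← mul_assoc,
        ← mul_assoc, ← mul_assoc, h.dunkl_mul (hLW hu) hcW hbW hcb]
      noncomm_ring
    have e4 : ∑ u ∈ L.toFinset, x u b *
          dunklProd x (insert b ((insert c W).erase u)) (L.erase u) =
        ∑ u ∈ L.toFinset, x u b *
          dunklProd x (insert b (insert c (W.erase u))) (L.erase u) :=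
      Finset.sum_congr rfl fun u hu => by rw [ebc u hu]
    rw [e3, dunklProd_cons, dunklProd_cons, ih1, e4]
    have e5 : ∑ u ∈ L.toFinset, (x u b - x u c) *
          dunklProd x (insert b (insert c (W.erase u))) (L.erase u) =
        dunklProd x (insert b W) L - dunklProd x (insert c W) L := by
      rw [← sub_eq_zero, ← brace]
      abel
    rw [e5, mul_add, dunkl_insert hb hcb]
    noncomm_ring

/-- `A k S` is the sum over all orderings of `S` of the products of the `x a k`, described by
splitting off the first factor. -/
structure IsOrderingSum (x : α → α → B) (A : α → Finset α → B) : Prop where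
  empty : ∀ k, A k ∅ = 1
  first : ∀ k (S : Finset α), S.Nonempty → A k S = ∑ u ∈ S, x u k * A k (S.erase u)

theorem MarkedRelations.commute_orderingSum (h : MarkedRelations x) {A : α → Finset α → B}
    (hA : IsOrderingSum x A) {p u c : α} (hpu : p ≠ u) (hpc : p ≠ c) (huc : u ≠ c)
    (S : Finset α) (hp : p ∉ S) (hu : u ∉ S) (hc : c ∉ S) : Commute (x p u) (A c S) := by
  induction S using Finset.strongInduction with
  | _ S ih =>
  rcases S.eq_empty_or_nonempty with rfl | hS
  · rw [hA.empty]
    exact Commute.one_right _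
  · rw [hA.first c S hS]
    refine Commute.sum_right _ _ _ fun v hv => Commute.mul_right ?_
      (ih _ (Finset.erase_ssubset hv) (by grind) (by grind) (by grind))
    exact h.comm _ _ _ _ hpu (by grind) (by grind) hpc (by grind) huc

theorem MarkedRelations.orderingSum_insert (h : MarkedRelations x) {A : α → Finset α → B}
    (hA : IsOrderingSum x A) {p c : α} {T : Finset α} (hp : p ∉ T) (hc : c ∉ T) (hcp : c ≠ p) :
    A c (insert p T) = A c T * (x p c + ∑ a ∈ T, x p a) +
      ∑ q ∈ T, x q p * A c (insert p (T.erase q)) := by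
  induction T using Finset.strongInduction with
  | _ T ih =>
  have hfirst : ∀ T : Finset α, p ∉ T → A c (insert p T) = x p c * A c T +
      ∑ u ∈ T, x u c * A c (insert p (T.erase u)) := by
    intro T hp
    rw [hA.first c _ (Finset.insert_nonempty _ _), Finset.sum_insert hp, Finset.erase_insert hp]
    congr 1
    exact Finset.sum_congr rfl fun u hu => by
      rw [Finset.erase_insert_of_ne (show p ≠ u by grind)]
  rcases T.eq_empty_or_nonempty with rfl | hT
  · rw [hfirst _ hp]
    simp [hA.empty]
  have swap : ∑ u ∈ T, x u c * (∑ q ∈ T.erase u, x q p * A c (insert p ((T.erase u).erase q))) =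
      ∑ q ∈ T, x q p * (∑ u ∈ T.erase q, x u c * A c (insert p ((T.erase q).erase u))) := by
    simp only [Finset.mul_sum]
    rw [Finset.sum_comm' (t' := T) (s' := fun v => T.erase v) (by grind)]
    refine Finset.sum_congr rfl fun q hq => Finset.sum_congr rfl fun u hu => ?_
    rw [← mul_assoc, ← mul_assoc, Finset.erase_right_comm, h.comm u c q p (by grind) (by grind)
      (by grind) (by grind) (by grind) hcp]
  have lhs : ∑ u ∈ T, x u c * A c (insert p (T.erase u)) =
      ∑ u ∈ T, x u c * (A c (T.erase u) * (x p c + ∑ a ∈ T.erase u, x p a)) +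
      ∑ u ∈ T, x u c *
        (∑ q ∈ T.erase u, x q p * A c (insert p ((T.erase u).erase q))) := by
    rw [← Finset.sum_add_distrib]
    refine Finset.sum_congr rfl fun u hu => ?_
    rw [ih _ (Finset.erase_ssubset hu) (by grind) (by grind), mul_add]
  have rhs : ∑ q ∈ T, x q p * A c (insert p (T.erase q)) =
      ∑ q ∈ T, x q p * (x p c * A c (T.erase q)) +
      ∑ q ∈ T, x q p * (∑ u ∈ T.erase q, x u c * A c (insert p ((T.erase q).erase u))) := by
    rw [← Finset.sum_add_distrib]
    exact Finset.sum_congr rfl fun q hq => by rw [hfirst (T.erase q) (by grind), mul_add]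
  rw [hfirst T hp, lhs, rhs, swap, hA.first c T hT, ← add_assoc, ← add_assoc]
  congr 1
  rw [Finset.sum_mul, Finset.mul_sum, ← Finset.sum_add_distrib, ← Finset.sum_add_distrib]
  refine Finset.sum_congr rfl fun u hu => ?_
  have hup : u ≠ p := by grind
  have huc : u ≠ c := by grind
  have hcomm : x p u * A c (T.erase u) = A c (T.erase u) * x p u :=
    h.commute_orderingSum hA hup.symm hcp.symm huc _ (by grind) (by grind) (by grind)
  rw [← Finset.add_sum_erase T (x p) hu, ← mul_assoc, h.tri p c u hcp.symm huc.symm hup, add_mul,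
    mul_assoc, hcomm]
  noncomm_ring

theorem MarkedRelations.dunklProd_eq_and_sum_mul_eq_zero (h : MarkedRelations x)
    {A : α → Finset α → B} (hA : IsOrderingSum x A) (m : ℕ) :
    (∀ (L : List α) (k : α), L.length = m → L.Nodup → k ∉ L →
      dunklProd x (insert k L.toFinset) L = A k L.toFinset) ∧
    (∀ (S : Finset α) (c : α), S.card = m → c ∉ S → (∑ a ∈ S, x c a) * A c S = 0) := by
  induction m with
  | zero =>
    refine ⟨fun L k hL _ _ => ?_, fun S c hS _ => ?_⟩
    · obtain rfl := List.length_eq_zero_iff.1 hL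
      simp [dunklProd, hA.empty]
    · obtain rfl := Finset.card_eq_zero.1 hS
      simp
  | succ m ih =>
    obtain ⟨ihM, ihN⟩ := ih
    have main : ∀ (L : List α) (k : α), L.length = m + 1 → L.Nodup → k ∉ L →
        dunklProd x (insert k L.toFinset) L = A k L.toFinset := by
      intro L k hlen hnd hk
      rw [h.dunklProd_insert _ L L.toFinset k rfl hnd subset_rfl (by simpa using hk)]
      have vanish : dunklProd x L.toFinset L = 0 := by
        match L, hlen, hnd with
        | c :: L, hlen, hnd =>
          obtain ⟨hcL, hnd⟩ := List.nodup_cons.1 hnd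
          have hlen : L.length = m := by simpa using hlen
          rw [dunklProd_cons, List.toFinset_cons, ihM L c hlen hnd hcL, dunkl,
            Finset.erase_insert (by simpa using hcL)]
          exact ihN _ c (by rw [List.toFinset_card_of_nodup hnd, hlen]) (by simpa using hcL)
      have hne : L.toFinset.Nonempty := by
        rw [List.toFinset_nonempty_iff]
        rintro rfl
        simp at hlen
      rw [vanish, zero_add, hA.first k _ hne]
      refine Finset.sum_congr rfl fun u hu => ?_
      have hu : u ∈ L := by simpa using hu
      rw [← toFinset_erase hnd, ihM (L.erase u) k (by rw [List.length_erase_of_mem hu]; omega)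
        (hnd.erase u) fun hk' => hk (List.mem_of_mem_erase hk')]
    refine ⟨main, fun S c hS hc => ?_⟩
    obtain ⟨p, hp⟩ : S.Nonempty := by
      rw [← Finset.card_pos]; omega
    obtain ⟨T, hpT, rfl⟩ : ∃ T, p ∉ T ∧ S = insert p T :=
      ⟨S.erase p, by simp, (Finset.insert_erase hp).symm⟩
    have hT : T.card = m := by rw [Finset.card_insert_of_notMem hpT] at hS; omega
    have hcp : c ≠ p := by grind
    have hcT : c ∉ T := by grind
    have step : ∀ q ∈ T, (x c p + ∑ a ∈ T, x c a) * (x q p * A c (insert p (T.erase q))) =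
        x c p * (x q p * A c (insert p (T.erase q))) -
          x c p * (x q c * A c (insert p (T.erase q))) := by
      intro q hq
      have hqp : q ≠ p := by grind
      have hqc : q ≠ c := by grind
      have h0 := ihN (insert p (T.erase q)) c
        (by rw [Finset.card_insert_of_notMem (by simp [hpT]), Finset.card_erase_of_mem hq, hT]
            have := Finset.card_pos.2 ⟨q, hq⟩
            omega) (by grind)
      rw [Finset.sum_insert (by simp [hpT])] at h0
      have h1 : (∑ a ∈ T.erase q, x c a) * x q p = x q p * ∑ a ∈ T.erase q, x c a := by
        rw [Finset.sum_mul, Finset.mul_sum]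
        exact Finset.sum_congr rfl fun a ha =>
          h.comm _ _ _ _ (by grind) hqp hqc.symm hcp (by grind) (by grind)
      have h2 := h.tri q p c hqp hcp.symm hqc.symm
      rw [← Finset.add_sum_erase T _ hq]
      calc _ = x c p * (x q p * A c (insert p (T.erase q))) +
            (x c q * x q p + (∑ a ∈ T.erase q, x c a) * x q p) *
              A c (insert p (T.erase q)) := by noncomm_ring
        _ = x c p * (x q p * A c (insert p (T.erase q))) -
              x c p * (x q c * A c (insert p (T.erase q))) +
            x q p * ((x c p + ∑ a ∈ T.erase q, x c a) * A c (insert p (T.erase q))) := by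
          rw [h1, eq_sub_of_add_eq' h2.symm]
          noncomm_ring
        _ = _ := by rw [h0, mul_zero, add_zero]
    have hfirst := hA.first c (insert p T) (Finset.insert_nonempty _ _)
    rw [Finset.sum_insert hpT, Finset.erase_insert hpT, Finset.sum_congr rfl fun q hq => by
      rw [Finset.erase_insert_of_ne (show p ≠ q by grind)]] at hfirst
    have hlast := h.orderingSum_insert hA hpT hcT hcp
    rw [Finset.sum_insert hpT]
    calc (x c p + ∑ a ∈ T, x c a) * A c (insert p T)
        = x c p * (A c T * (x p c + ∑ a ∈ T, x p a)) +
          ((∑ a ∈ T, x c a) * A c T) * (x p c + ∑ a ∈ T, x p a) +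
          ∑ q ∈ T, (x c p + ∑ a ∈ T, x c a) * (x q p * A c (insert p (T.erase q))) := by
          rw [hlast, ← Finset.mul_sum]
          noncomm_ring
      _ = x c p * A c (insert p T) - x c p * ∑ q ∈ T, x q c * A c (insert p (T.erase q)) := by
          rw [ihN T c hT hcT, Finset.sum_congr rfl step, Finset.sum_sub_distrib,
            ← Finset.mul_sum, ← Finset.mul_sum, hlast]
          noncomm_ring
      _ = (x c p * x p c) * A c T := by
          rw [hfirst]
          noncomm_ring
      _ = 0 := by rw [h.sq c p hcp, zero_mul]

/-- The sum over the words of length `m` with letter set `S` of the products of the `x a k`. -/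
def wordSum [Fintype α] (x : α → α → B) (k : α) (m : ℕ) (S : Finset α) : B :=
  ∑ f : Fin m → α with Finset.univ.image f = S, (List.ofFn fun i => x (f i) k).prod

theorem image_cons_eq_iff {m : ℕ} {S : Finset α} (hS : S.card = m + 1) (u : α) (g : Fin m → α) :
    Finset.univ.image (Fin.cons u g : Fin (m + 1) → α) = S ↔
      u ∈ S ∧ Finset.univ.image g = S.erase u := by
  have himage : Finset.univ.image (Fin.cons u g : Fin (m + 1) → α) =
      insert u (Finset.univ.image g) := by
    ext v
    simp [Fin.exists_fin_succ, eq_comm]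
  rw [himage]
  constructor
  · rintro rfl
    have hu : u ∉ Finset.univ.image g := by
      intro hu
      have := Finset.card_image_le (s := Finset.univ) (f := g)
      rw [Finset.insert_eq_of_mem hu] at hS
      simp at this
      omega
    exact ⟨Finset.mem_insert_self _ _, (Finset.erase_insert hu).symm⟩
  · rintro ⟨hu, hg⟩
    rw [hg, Finset.insert_erase hu]

theorem wordSum_succ [Fintype α] (x : α → α → B) (k : α) {m : ℕ} {S : Finset α}
    (hS : S.card = m + 1) :
    wordSum x k (m + 1) S = ∑ u ∈ S, x u k * wordSum x k m (S.erase u) := by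
  unfold wordSum
  simp only [Finset.sum_filter, Finset.mul_sum]
  rw [← (Fin.consEquiv fun _ : Fin (m + 1) => α).sum_comp, Fintype.sum_prod_type,
    ← Finset.sum_filter_add_sum_filter_not Finset.univ (· ∈ S)]
  rw [Finset.sum_eq_zero (s := Finset.univ.filter (· ∉ S)), add_zero, Finset.filter_mem_eq_inter,
    Finset.univ_inter]
  · refine Finset.sum_congr rfl fun u hu => Finset.sum_congr rfl fun g _ => ?_
    have := image_cons_eq_iff hS u g
    simp [Fin.consEquiv, this, hu, List.ofFn_succ]
  · intro u hu
    refine Finset.sum_eq_zero fun g _ => ?_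
    have := image_cons_eq_iff hS u g
    simp at hu
    simp [Fin.consEquiv, this, hu]

theorem isOrderingSum_wordSum [Fintype α] (x : α → α → B) :
    IsOrderingSum x fun k S => wordSum x k S.card S where
  empty k := by
    show wordSum x k 0 ∅ = 1
    rw [wordSum, Finset.filter_true_of_mem (by simp)]
    simp
  first k S hS := by
    obtain ⟨m, hm⟩ : ∃ m, S.card = m + 1 := ⟨S.card - 1, by have := hS.card_pos; omega⟩
    simp only [hm]
    rw [wordSum_succ x k hm]
    refine Finset.sum_congr rfl fun u hu => ?_
    rw [Finset.card_erase_of_mem hu, hm, Nat.add_sub_cancel]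

end MarkedRelations

open scoped TensorProduct

theorem List.eraseIdx_ofFn_succAbove {β : Type*} {m : ℕ} (f : Fin (m + 1) → β)
    (k : Fin (m + 1)) :
    (List.ofFn f).eraseIdx (k : ℕ) = List.ofFn fun i => f (k.succAbove i) := by
  have hk := k.2
  apply List.ext_getElem
  · simp [List.length_eraseIdx]; omega
  · intro i h1 h2
    simp only [List.getElem_eraseIdx, List.getElem_ofFn, Fin.succAbove]
    split_ifs with h3 h4 h4
    · rfl
    · simp [Fin.lt_def] at h4; omega
    · simp [Fin.lt_def] at h4; omega
    · rfl

theorem prod_ofFn_tmul {P R : Type*} [Ring P] [Ring R] {m : ℕ} (ξ : Fin m → P) (y : Fin m → R) :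
    (List.ofFn fun i => ξ i ⊗ₜ[ℤ] y i).prod =
      (List.ofFn ξ).prod ⊗ₜ[ℤ] (List.ofFn y).prod := by
  induction m with
  | zero => simp [Algebra.TensorProduct.one_def]
  | succ m ih => simp [List.ofFn_succ, ih, Algebra.TensorProduct.tmul_mul_tmul]

/-- Marking the generators of the quadratic algebra by anticommuting variables. -/
theorem markedRelations_tmul {α M R : Type*} [AddCommGroup M] [Ring R]
    (v : α → M) (e : α → α → R)
    (hsymm : ∀ a b, a ≠ b → e a b = e b a)
    (hsq : ∀ a b, a ≠ b → e a b * e a b = 0)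
    (hdisj : ∀ a b c d, a ≠ b → c ≠ d → a ≠ c → a ≠ d → b ≠ c → b ≠ d →
      e a b * e c d + e c d * e a b = 0)
    (htri : ∀ a b c, a ≠ b → b ≠ c → c ≠ a →
      e a b * e b c + e b c * e c a + e c a * e a b = 0) :
    MarkedRelations fun a b => ExteriorAlgebra.ι ℤ (v a) ⊗ₜ[ℤ] e a b where
  comm a b c d hab hcd hac had hbc hbd := by
    rw [Algebra.TensorProduct.tmul_mul_tmul, Algebra.TensorProduct.tmul_mul_tmul,
      eq_neg_of_add_eq_zero_left (hdisj a b c d hab hcd hac had hbc hbd),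
      eq_neg_of_add_eq_zero_left (ExteriorAlgebra.ι_add_mul_swap (R := ℤ) (v a) (v c)),
      TensorProduct.neg_tmul, TensorProduct.tmul_neg, neg_neg]
  tri a b c hab hbc hca := by
    have h := htri a b c hab hbc hca
    rw [hsymm b c hbc, hsymm c a hca, add_assoc] at h
    simp only [Algebra.TensorProduct.tmul_mul_tmul]
    rw [hsymm c a hca, ← TensorProduct.tmul_add, eq_neg_of_add_eq_zero_left h,
      eq_neg_of_add_eq_zero_left (ExteriorAlgebra.ι_add_mul_swap (R := ℤ) (v a) (v c)),
      TensorProduct.neg_tmul, TensorProduct.tmul_neg, neg_neg]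
  sq a b hab := by
    rw [Algebra.TensorProduct.tmul_mul_tmul, ← hsymm a b hab, hsq a b hab,
      TensorProduct.tmul_zero]

/-- The coefficient of the top exterior power. -/
theorem exists_topCoeff (m : ℕ) (R : Type*) [Ring R] :
    ∃ Φ : ExteriorAlgebra ℤ (Fin m → ℤ) ⊗[ℤ] R →+ R, ∀ (τ : Equiv.Perm (Fin m)) (r : R),
      Φ ((List.ofFn fun i => ExteriorAlgebra.ι ℤ (Pi.single (τ i) (1 : ℤ) : Fin m → ℤ)).prod
        ⊗ₜ[ℤ] r) = ((Equiv.Perm.sign τ : ℤ) : R) * r := by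
  let φ : ExteriorAlgebra ℤ (Fin m → ℤ) →ₗ[ℤ] ℤ :=
    ExteriorAlgebra.liftAlternating (Pi.single m Matrix.detRowAlternating)
  refine ⟨((TensorProduct.lid ℤ R).toLinearMap ∘ₗ φ.rTensor R).toAddMonoidHom, fun τ r => ?_⟩
  have h : φ (List.ofFn fun i =>
      ExteriorAlgebra.ι ℤ (Pi.single (τ i) (1 : ℤ) : Fin m → ℤ)).prod = Equiv.Perm.sign τ := by
    rw [← ExteriorAlgebra.ιMulti_apply]
    simp only [φ, ExteriorAlgebra.liftAlternating_apply_ιMulti, Pi.single_eq_same]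
    have hid : (Matrix.detRowAlternating fun i => (Pi.single i (1 : ℤ) : Fin m → ℤ)) = 1 := by
      rw [← Matrix.det_one (n := Fin m) (R := ℤ)]
      congr 1
      ext i j
      simp [Matrix.one_apply, Pi.single_apply, eq_comm]
    have := Matrix.detRowAlternating.map_perm
      (fun i => (Pi.single i (1 : ℤ) : Fin m → ℤ)) τ
    rw [hid] at this
    simpa [Function.comp_def, Units.smul_def] using this
  simp [h]

theorem sum_filter_perm_fix {A : Type*} [AddCommMonoid A] {m : ℕ} (k : Fin (m + 1))
    (F : ℤ → (Fin m → Fin (m + 1)) → A) :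
    ∑ σ : Equiv.Perm (Fin (m + 1)) with σ k = k,
        F (Equiv.Perm.sign σ) (fun i => σ (k.succAbove i)) =
      ∑ τ : Equiv.Perm (Fin m), F (Equiv.Perm.sign τ) fun i => k.succAbove (τ i) := by
  symm
  refine Finset.sum_bij (fun τ _ => τ.extendDomain (finSuccAboveEquiv k)) ?_ ?_ ?_ ?_
  · intro τ _
    simp only [Finset.mem_filter, Finset.mem_univ, true_and]
    exact Equiv.Perm.extendDomain_apply_not_subtype τ (finSuccAboveEquiv k) (by simp)
  · intro τ _ τ' _ h
    exact Equiv.Perm.extendDomainHom_injective (finSuccAboveEquiv k) h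
  · intro σ hσ
    have hσ : σ k = k := by simpa using hσ
    have hne : ∀ a, σ a ≠ k ↔ a ≠ k := fun a => by
      rw [not_iff_not]
      exact ⟨fun h => σ.injective (h.trans hσ.symm), fun h => h ▸ hσ⟩
    refine ⟨(finSuccAboveEquiv k).symm.permCongr (σ.subtypePerm hne), Finset.mem_univ _, ?_⟩
    ext1 a
    by_cases ha : a = k
    · subst ha
      rw [Equiv.Perm.extendDomain_apply_not_subtype _ _ (by simp), hσ]
    · rw [Equiv.Perm.extendDomain_apply_subtype _ (finSuccAboveEquiv k) ha]
      simp [Equiv.permCongr_apply]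
  · intro τ _
    rw [Equiv.Perm.sign_extendDomain]
    congr 1
    funext i
    exact (Equiv.Perm.extendDomain_apply_image τ (finSuccAboveEquiv k) i).symm

theorem wordSum_erase_eq_sum_perm {B : Type*} [Ring B] {m : ℕ}
    (x : Fin (m + 1) → Fin (m + 1) → B) (k : Fin (m + 1)) :
    wordSum x k m (Finset.univ.erase k) =
      ∑ τ : Equiv.Perm (Fin m), (List.ofFn fun i => x (k.succAbove (τ i)) k).prod := by
  symm
  refine Finset.sum_bij (fun τ _ i => k.succAbove (τ i)) ?_ ?_ ?_ fun _ _ => rfl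
  · intro τ _
    simp only [Finset.mem_filter, Finset.mem_univ, true_and]
    ext a
    simp only [Finset.mem_image, Finset.mem_univ, true_and, Finset.mem_erase, and_true]
    constructor
    · rintro ⟨i, rfl⟩
      exact k.succAbove_ne _
    · intro ha
      obtain ⟨j, rfl⟩ := Fin.exists_succAbove_eq ha
      exact ⟨τ.symm j, by simp⟩
  · intro τ _ τ' _ h
    ext1 i
    exact Fin.succAbove_right_injective (congrFun h i)
  · intro f hf
    simp only [Finset.mem_filter, Finset.mem_univ, true_and] at hf
    have hne : ∀ i, f i ≠ k := fun i =>
      Finset.ne_of_mem_erase (hf ▸ Finset.mem_image_of_mem f (Finset.mem_univ i))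
    choose g hg using fun i => Fin.exists_succAbove_eq (hne i)
    have hsurj : Function.Surjective g := by
      intro j
      have hj : k.succAbove j ∈ Finset.univ.image f := by
        rw [hf]; simp
      obtain ⟨i, -, hi⟩ := Finset.mem_image.1 hj
      exact ⟨i, Fin.succAbove_right_injective ((hg i).trans hi)⟩
    exact ⟨Equiv.ofBijective g ⟨Finite.injective_iff_surjective.2 hsurj, hsurj⟩,
      Finset.mem_univ _, funext hg⟩

/-- Lemma 5.4 of Kirillov–Maeno: for every `k`,
`∏_{j ≠ k} θ_j = Σ_σ sgn(σ) ∏_{j ≠ k} e(σ(j), k)`,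
where `σ` runs over the permutations of `{1,…,n} \ {k}` (encoded as the
permutations of `Fin n` fixing `k`) and both products are taken in increasing
order of the index `j`. -/
theorem lem54_typeA (n : ℕ) (hn : 1 ≤ n) (R : Type*) [Ring R]
    (e : Fin n → Fin n → R)
    (hsymm : ∀ a b : Fin n, a ≠ b → e a b = e b a)
    (hsq : ∀ a b : Fin n, a ≠ b → e a b * e a b = 0)
    (hdisj : ∀ a b c d : Fin n, a ≠ b → c ≠ d → a ≠ c → a ≠ d → b ≠ c → b ≠ d →
      e a b * e c d + e c d * e a b = 0)
    (htri : ∀ a b c : Fin n, a ≠ b → b ≠ c → c ≠ a →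
      e a b * e b c + e b c * e c a + e c a * e a b = 0)
    (θ : Fin n → R)
    (hθ : ∀ i : Fin n, θ i = ∑ j ∈ Finset.univ.filter (fun j => j ≠ i), e i j) :
    ∀ k : Fin n,
      ((List.ofFn θ).eraseIdx (k : ℕ)).prod =
        ∑ σ ∈ Finset.univ.filter (fun σ : Equiv.Perm (Fin n) => σ k = k),
          ((Equiv.Perm.sign σ : ℤ) : R) *
            ((List.ofFn (fun j => e (σ j) k)).eraseIdx (k : ℕ)).prod := by
  intro k
  obtain ⟨m, rfl⟩ : ∃ m, n = m + 1 := ⟨n - 1, by omega⟩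
  let v : Fin (m + 1) → Fin m → ℤ := fun a j => if a = k.succAbove j then 1 else 0
  have hv : ∀ j, v (k.succAbove j) = Pi.single j 1 := by
    intro j
    ext i
    simp [v, Pi.single_apply, eq_comm]
  set x : Fin (m + 1) → Fin (m + 1) → ExteriorAlgebra ℤ (Fin m → ℤ) ⊗[ℤ] R :=
    fun a b => ExteriorAlgebra.ι ℤ (v a) ⊗ₜ[ℤ] e a b with hx
  have hrel : MarkedRelations x := markedRelations_tmul v e hsymm hsq hdisj htri
  have hmain := (hrel.dunklProd_eq_and_sum_mul_eq_zero (isOrderingSum_wordSum x) m).1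
    (List.ofFn k.succAbove) k (by simp)
    (List.nodup_ofFn.2 Fin.succAbove_right_injective)
    (by simp [List.mem_ofFn, Fin.succAbove_ne])
  have hset : (List.ofFn k.succAbove).toFinset = Finset.univ.erase k := by
    ext a
    simp [List.mem_ofFn, Fin.exists_succAbove_eq_iff]
  have hdunkl : ∀ a, dunkl x Finset.univ a = ExteriorAlgebra.ι ℤ (v a) ⊗ₜ[ℤ] θ a := by
    intro a
    rw [hθ, TensorProduct.tmul_sum, dunkl, Finset.filter_ne' Finset.univ a]
  obtain ⟨Φ, hΦ⟩ := exists_topCoeff m R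
  rw [hset, Finset.insert_erase (Finset.mem_univ k), Finset.card_erase_of_mem (Finset.mem_univ k),
    Finset.card_univ, Fintype.card_fin, Nat.add_sub_cancel, wordSum_erase_eq_sum_perm, dunklProd,
    List.map_ofFn] at hmain
  simp only [Function.comp_def, hdunkl] at hmain
  simp only [hx, prod_ofFn_tmul, hv] at hmain
  have hcoeff := congrArg Φ hmain
  rw [map_sum] at hcoeff
  have hone := hΦ 1 (List.ofFn fun i => θ (k.succAbove i)).prod
  simp only [Equiv.Perm.one_apply, Equiv.Perm.sign_one, Units.val_one, Int.cast_one,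
    one_mul] at hone
  rw [hone] at hcoeff
  simp only [hΦ] at hcoeff
  simp only [List.eraseIdx_ofFn_succAbove]
  rw [hcoeff]
  exact (sum_filter_perm_fix k fun s f => (s : R) * (List.ofFn fun i => e (f i) k).prod).symm
end

section
/- Lemma 5.5. For any m ≥ 2 and any distinct elements a_1, …, a_m of {1,…,n}, Σ_{k=1}^{m} (−1)^{(m−1)(k−1)} (∏_{j=k+1}^{m} e(a_k,a_j)) (∏_{j=1}^{k−1} e(a_j,a_k)) = 0, where each product ∏ is taken in increasing order of the index j. -/
/-- Moving an element past a product of elements it anticommutes with. -/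
theorem list_prod_mul_of_anticomm {R : Type*} [Ring R] (w : R) (l : List R)
    (h : ∀ y ∈ l, w * y + y * w = 0) : l.prod * w = (-1) ^ l.length * (w * l.prod) := by
  induction l with
  | nil => simp
  | cons y l ih =>
    have hy : y * w = -(w * y) := eq_neg_of_add_eq_zero_right (h y (by simp))
    have hc : y * (-1 : R) ^ l.length = (-1) ^ l.length * y :=
      ((Commute.neg_one_right y).pow_right _).eq
    rw [List.prod_cons, mul_assoc, ih fun z hz => h z (by simp [hz]), ← mul_assoc, hc, mul_assoc,
      ← mul_assoc y, hy, List.length_cons, pow_succ]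
    simp [mul_assoc]

/-- Rewriting a summand of the cyclic sum on the points `…, y, x` centred at `c` by summands of
the sums with `x` or `y` omitted; here `u = e c y`, `v = e c x`, `w = e y x`. -/
theorem sign_mul_star_eq {R : Type*} [Ring R] (k d : ℕ) (A P u v w : R)
    (huv : u * v = -(w * u + v * w)) (hA : A * w = (-1) ^ d * (w * A))
    (hP : P * w = (-1) ^ k * (w * P)) :
    (-1) ^ ((k + 1 + d + 1) * k) * (A * u * v * P) =
      (-1) ^ (k + 1 + d) * (w * ((-1) ^ ((k + 1 + d) * k) * (A * u * P))) -
        (-1) ^ ((k + 1 + d) * k) * (A * v * P) * w := by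
  have hwP : w * P = (-1) ^ k * (P * w) := by
    rw [hP, ← mul_assoc, ← pow_add, Even.neg_one_pow ⟨k, rfl⟩, one_mul]
  have h : A * u * v * P =
      -((-1) ^ d * (w * A) * u * P) - A * v * ((-1) ^ k * (P * w)) := by
    rw [mul_assoc A, huv, ← hA, ← hwP]; noncomm_ring
  rw [h]
  rcases Nat.even_or_odd k with hk | hk <;> rcases Nat.even_or_odd d with hd | hd <;>
    simp [pow_mul, pow_add, hk.neg_one_pow, hd.neg_one_pow] <;> noncomm_ring

/-- The cyclic relation for the points `a 1, …, a p, x`, with `x` singled out. -/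
theorem sum_star_add_eq_zero {ι R : Type*} [Ring R] (e : ι → ι → R)
    (hsymm : ∀ a b : ι, a ≠ b → e a b = e b a)
    (hdisj : ∀ a b c d : ι, a ≠ b → c ≠ d → a ≠ c → a ≠ d → b ≠ c → b ≠ d →
      e a b * e c d + e c d * e a b = 0)
    (htri : ∀ a b c : ι, a ≠ b → b ≠ c → c ≠ a →
      e a b * e b c + e b c * e c a + e c a * e a b = 0)
    (a : ℕ → ι) (p : ℕ) (hp : 1 ≤ p) (x : ι)
    (hinj : ∀ i j : ℕ, 1 ≤ i → i ≤ p → 1 ≤ j → j ≤ p → i ≠ j → a i ≠ a j)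
    (hx : ∀ i : ℕ, 1 ≤ i → i ≤ p → a i ≠ x) :
    ∑ k ∈ Finset.range p, (-1 : R) ^ (p * k) *
      (((List.range' (k + 2) (p - (k + 1))).map fun j => e (a (k + 1)) (a j)).prod *
        e (a (k + 1)) x * ((List.range' 1 k).map fun j => e (a j) (a (k + 1))).prod) +
      (-1) ^ p * ((List.range' 1 p).map fun j => e (a j) x).prod = 0 := by
  induction p, hp using Nat.le_induction generalizing x with
  | base => simp
  | succ p hp ih =>
    have hinj' : ∀ i j : ℕ, 1 ≤ i → i ≤ p → 1 ≤ j → j ≤ p → i ≠ j → a i ≠ a j :=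
      fun i j h1 h2 h3 h4 => hinj i j h1 (by omega) h3 (by omega)
    have ihx := ih x hinj' fun i h1 h2 => hx i h1 (by omega)
    have ihy := ih (a (p + 1)) hinj' fun i h1 h2 =>
      hinj i (p + 1) h1 (by omega) (by omega) le_rfl (by omega)
    have hyx : a (p + 1) ≠ x := hx _ (by omega) le_rfl
    have anticomm : ∀ i j : ℕ, 1 ≤ i → i ≤ p → 1 ≤ j → j ≤ p → i ≠ j →
        e (a (p + 1)) x * e (a i) (a j) + e (a i) (a j) * e (a (p + 1)) x = 0 := by
      intro i j h1 h2 h3 h4 hij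
      exact hdisj _ _ _ _ hyx (hinj' i j h1 h2 h3 h4 hij)
        (hinj _ _ (by omega) le_rfl h1 (by omega) (by omega))
        (hinj _ _ (by omega) le_rfl h3 (by omega) (by omega))
        (hx i h1 (by omega)).symm (hx j h3 (by omega)).symm
    have step : ∀ k ∈ Finset.range p,
        (-1 : R) ^ ((p + 1) * k) *
          (((List.range' (k + 2) (p + 1 - (k + 1))).map fun j => e (a (k + 1)) (a j)).prod *
            e (a (k + 1)) x * ((List.range' 1 k).map fun j => e (a j) (a (k + 1))).prod) =
        (-1) ^ p * (e (a (p + 1)) x * ((-1) ^ (p * k) *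
          (((List.range' (k + 2) (p - (k + 1))).map fun j => e (a (k + 1)) (a j)).prod *
            e (a (k + 1)) (a (p + 1)) * ((List.range' 1 k).map fun j => e (a j) (a (k + 1))).prod))) -
        (-1) ^ (p * k) *
          (((List.range' (k + 2) (p - (k + 1))).map fun j => e (a (k + 1)) (a j)).prod *
            e (a (k + 1)) x * ((List.range' 1 k).map fun j => e (a j) (a (k + 1))).prod) *
          e (a (p + 1)) x := by
      intro k hk
      obtain ⟨d, rfl⟩ := Nat.exists_eq_add_of_le (Finset.mem_range.mp hk : k + 1 ≤ p)
      rw [show k + 1 + d + 1 - (k + 1) = d + 1 by omega, show k + 1 + d - (k + 1) = d by omega,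
        List.range'_concat, List.map_append, List.prod_append]
      simp only [List.map_cons, List.map_nil, List.prod_singleton, one_mul,
        show k + 2 + d = k + 1 + d + 1 by omega]
      refine sign_mul_star_eq k d _ _ _ _ (e (a (k + 1 + d + 1)) x) ?_ ?_ ?_
      · have hcy : a (k + 1) ≠ a (k + 1 + d + 1) :=
          hinj _ _ (by omega) (by omega) (by omega) le_rfl (by omega)
        have hcx : a (k + 1) ≠ x := hx _ (by omega) (by omega)
        have := htri _ _ _ hcy.symm hcx hyx.symm
        rw [hsymm _ _ hcy.symm, hsymm _ _ hyx.symm] at this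
        rw [add_comm (_ * _), ← add_eq_zero_iff_eq_neg, ← add_assoc, this]
      · refine (list_prod_mul_of_anticomm _ _ ?_).trans (by simp)
        simp only [List.mem_map, List.mem_range'_1]
        rintro _ ⟨j, hj, rfl⟩
        exact anticomm _ _ (by omega) (by omega) (by omega) (by omega) (by omega)
      · refine (list_prod_mul_of_anticomm _ _ ?_).trans (by simp)
        simp only [List.mem_map, List.mem_range'_1]
        rintro _ ⟨j, hj, rfl⟩
        exact anticomm _ _ (by omega) (by omega) (by omega) (by omega) (by omega)
    rw [Finset.sum_range_succ, Finset.sum_congr rfl step, Finset.sum_sub_distrib,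
      ← Finset.sum_mul, ← Finset.mul_sum, ← Finset.mul_sum,
      eq_neg_of_add_eq_zero_left ihx, eq_neg_of_add_eq_zero_left ihy, List.range'_concat]
    rcases Nat.even_or_odd p with h | h
    · simp [pow_mul, pow_add, h.neg_one_pow, add_comm 1 p]
    · simp [pow_mul, pow_add, h.neg_one_pow, add_comm 1 p]
      abel

/-- Lemma 5.5 of Kirillov–Maeno. For distinct `a 1, …, a m` in `Λ_quad(A_{n-1})`:
`Σ_{k=1}^m (-1)^{(m-1)(k-1)} (∏_{j=k+1}^m e(a_k,a_j)) (∏_{j=1}^{k-1} e(a_j,a_k)) = 0`. -/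
theorem lem55_typeA (n : ℕ) (hn : 1 ≤ n) (R : Type*) [Ring R]
    (e : Fin n → Fin n → R)
    (hsymm : ∀ a b : Fin n, a ≠ b → e a b = e b a)
    (hsq : ∀ a b : Fin n, a ≠ b → e a b * e a b = 0)
    (hdisj : ∀ a b c d : Fin n, a ≠ b → c ≠ d → a ≠ c → a ≠ d → b ≠ c → b ≠ d →
      e a b * e c d + e c d * e a b = 0)
    (htri : ∀ a b c : Fin n, a ≠ b → b ≠ c → c ≠ a →
      e a b * e b c + e b c * e c a + e c a * e a b = 0)
    (m : ℕ) (hm : 2 ≤ m) (a : ℕ → Fin n)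
    (hinj : ∀ i j : ℕ, 1 ≤ i → i ≤ m → 1 ≤ j → j ≤ m → i ≠ j → a i ≠ a j) :
    ∑ k ∈ Finset.Icc 1 m, (-1 : R) ^ ((m - 1) * (k - 1)) *
      (((List.range' (k + 1) (m - k)).map (fun j => e (a k) (a j))).prod *
        ((List.range' 1 (k - 1)).map (fun j => e (a j) (a k))).prod) = 0 := by
  obtain ⟨p, rfl⟩ : ∃ p, m = p + 1 := ⟨m - 1, by omega⟩
  have key := sum_star_add_eq_zero e hsymm hdisj htri a p (by omega) (a (p + 1))
    (fun i j h1 h2 h3 h4 => hinj i j h1 (by omega) h3 (by omega))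
    fun i h1 h2 => hinj i (p + 1) h1 (by omega) (by omega) le_rfl (by omega)
  have hsign : (-1 : R) ^ (p * p) = (-1) ^ p := by
    rcases Nat.even_or_odd p with h | h <;> simp [pow_mul, h.neg_one_pow]
  rw [← Finset.Ico_add_one_right_eq_Icc, Finset.sum_Ico_eq_sum_range, Nat.add_sub_cancel,
    Finset.sum_range_succ, ← key]
  congr 1
  · refine Finset.sum_congr rfl fun k hk => ?_
    have hk' := Finset.mem_range.mp hk
    rw [show p + 1 - (1 + k) = p - (k + 1) + 1 by omega, List.range'_concat, add_comm 1 k,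
      show k + 1 + 1 + 1 * (p - (k + 1)) = p + 1 by omega]
    simp
  · simp [add_comm 1 p, hsign]
end

section
/- (Identity used in the proof of Lemma 5.5.) For any m ≥ 3 and any distinct elements a_1, …, a_m of {1,…,n}, ∏_{j=1}^{m−1} e(a_j,a_m) = (−1)^{m−2} (∏_{j=2}^{m−1} e(a_j,a_m)) · e(a_1,a_2) − e(a_1,a_2) e(a_1,a_m) ∏_{j=3}^{m−1} e(a_j,a_m), where each product ∏ is taken in increasing order of the index j (and an empty product equals 1). -/
/-- Moving an element past a product of elements that anticommute with it
produces one sign for each factor. -/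
theorem mul_list_prod_of_anticommute {R : Type*} [Ring R] (z : R) (l : List R)
    (h : ∀ x ∈ l, z * x = -(x * z)) :
    z * l.prod = (-1) ^ l.length * l.prod * z := by
  induction l with
  | nil => simp
  | cons x l ih =>
    have hl := ih fun y hy => h y (List.mem_cons_of_mem x hy)
    have hx : (-1 : R) ^ l.length * x = x * (-1) ^ l.length :=
      ((Commute.neg_one_left x).pow_left l.length).eq
    rw [List.prod_cons, ← mul_assoc, h x List.mem_cons_self, neg_mul, mul_assoc, hl,
      List.length_cons, pow_succ]
    simp only [mul_neg, mul_one, neg_mul, ← mul_assoc, hx]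

/-- The identity used in the proof of Lemma 5.5 of Kirillov–Maeno.
For distinct `a 1, …, a m` (with `m ≥ 3`) in `Λ_quad(A_{n-1})`:
`∏_{j=1}^{m-1} e(a_j,a_m) = (-1)^{m-2} (∏_{j=2}^{m-1} e(a_j,a_m)) e(a_1,a_2)
  - e(a_1,a_2) e(a_1,a_m) ∏_{j=3}^{m-1} e(a_j,a_m)`. -/
theorem lem55_identity_typeA (n : ℕ) (hn : 1 ≤ n) (R : Type*) [Ring R]
    (e : Fin n → Fin n → R)
    (hsymm : ∀ a b : Fin n, a ≠ b → e a b = e b a)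
    (hsq : ∀ a b : Fin n, a ≠ b → e a b * e a b = 0)
    (hdisj : ∀ a b c d : Fin n, a ≠ b → c ≠ d → a ≠ c → a ≠ d → b ≠ c → b ≠ d →
      e a b * e c d + e c d * e a b = 0)
    (htri : ∀ a b c : Fin n, a ≠ b → b ≠ c → c ≠ a →
      e a b * e b c + e b c * e c a + e c a * e a b = 0)
    (m : ℕ) (hm : 3 ≤ m) (a : ℕ → Fin n)
    (hinj : ∀ i j : ℕ, 1 ≤ i → i ≤ m → 1 ≤ j → j ≤ m → i ≠ j → a i ≠ a j) :
    ((List.range' 1 (m - 1)).map (fun j => e (a j) (a m))).prod =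
      (-1 : R) ^ (m - 2) *
          ((List.range' 2 (m - 2)).map (fun j => e (a j) (a m))).prod * e (a 1) (a 2) -
        e (a 1) (a 2) * e (a 1) (a m) *
          ((List.range' 3 (m - 3)).map (fun j => e (a j) (a m))).prod := by
  obtain ⟨k, rfl⟩ : ∃ k, m = k + 3 := ⟨m - 3, by omega⟩
  have ne {i j : ℕ} (hi : 1 ≤ i) (hi' : i ≤ k + 3) (hj : 1 ≤ j) (hj' : j ≤ k + 3)
      (hij : i ≠ j) : a i ≠ a j := hinj i j hi hi' hj hj' hij
  have h12 : a 1 ≠ a 2 := ne (by omega) (by omega) (by omega) (by omega) (by omega)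
  have h1m : a 1 ≠ a (k + 3) := ne (by omega) (by omega) (by omega) (by omega) (by omega)
  have h2m : a 2 ≠ a (k + 3) := ne (by omega) (by omega) (by omega) (by omega) (by omega)
  have hP := mul_list_prod_of_anticommute (e (a 1) (a 2))
    ((List.range' 3 k).map fun j => e (a j) (a (k + 3))) (by
      intro x hx
      obtain ⟨j, hj, rfl⟩ := List.mem_map.1 hx
      rw [List.mem_range'_1] at hj
      refine eq_neg_of_add_eq_zero_left (hdisj _ _ _ _ h12 ?_ ?_ h1m ?_ h2m) <;>
        exact ne (by omega) (by omega) (by omega) (by omega) (by omega))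
  rw [List.length_map, List.length_range'] at hP
  have ht := htri (a 1) (a (k + 3)) (a 2) h1m h2m.symm h12.symm
  rw [hsymm _ _ h2m.symm, hsymm _ _ h12.symm, add_assoc] at ht
  have hxy := eq_neg_of_add_eq_zero_left ht
  rw [show k + 3 - 1 = k + 1 + 1 by omega, show k + 3 - 2 = k + 1 by omega,
    show k + 3 - 3 = k by omega]
  simp only [List.range'_succ, List.map_cons, List.prod_cons, Nat.reduceAdd]
  have hy : (-1 : R) ^ k * e (a 2) (a (k + 3)) = e (a 2) (a (k + 3)) * (-1) ^ k :=
    ((Commute.neg_one_left _).pow_left k).eq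
  rw [← mul_assoc, hxy, neg_mul, add_mul, mul_assoc (e (a 2) (a (k + 3))), hP, pow_succ]
  simp only [mul_neg, mul_one, neg_mul, ← mul_assoc, hy]
  abel
end

section
/- (Key identities in the proof of Proposition 5.1.) Define E(i,j) := e(i,j) + ē(i,j) for all distinct i,j ∈ {1,…,n}. Then the elements E(i,j) satisfy the defining relations of Λ_quad(A_{n−1}): (a) E(i,j)² = 0 for all distinct i,j; (b) E(i,j)E(k,l) + E(k,l)E(i,j) = 0 whenever {i,j} ∩ {k,l} = ∅; (c) E(i,j)E(j,k) + E(j,k)E(k,i) + E(k,i)E(i,j) = 0 for all distinct i,j,k. -/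
/-- Key identities in the proof of Proposition 5.1 of Kirillov–Maeno:
the elements `E(i,j) := e(i,j) + ē(i,j)` of `Λ_quad(D_n)` satisfy the
defining relations of `Λ_quad(A_{n-1})`. `ebar` denotes `ē`. -/
theorem E_relations_typeD (n : ℕ) (hn : 1 ≤ n) (R : Type*) [Ring R]
    (e ebar : Fin n → Fin n → R)
    (hsymm : ∀ i j : Fin n, i ≠ j → e i j = e j i)
    (hsymmb : ∀ i j : Fin n, i ≠ j → ebar i j = ebar j i)
    (hsq : ∀ i j : Fin n, i ≠ j → e i j * e i j = 0)
    (hsqb : ∀ i j : Fin n, i ≠ j → ebar i j * ebar i j = 0)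
    (hdisj : ∀ i j k l : Fin n, i ≠ j → k ≠ l → i ≠ k → i ≠ l → j ≠ k → j ≠ l →
      e i j * e k l + e k l * e i j = 0)
    (hdisjb : ∀ i j k l : Fin n, i ≠ j → k ≠ l → i ≠ k → i ≠ l → j ≠ k → j ≠ l →
      e i j * ebar k l + ebar k l * e i j = 0)
    (hdisjbb : ∀ i j k l : Fin n, i ≠ j → k ≠ l → i ≠ k → i ≠ l → j ≠ k → j ≠ l →
      ebar i j * ebar k l + ebar k l * ebar i j = 0)
    (hmix : ∀ i j : Fin n, i ≠ j → e i j * ebar i j + ebar i j * e i j = 0)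
    (htri : ∀ i j k : Fin n, i ≠ j → j ≠ k → k ≠ i →
      e i j * e j k + e j k * e k i + e k i * e i j = 0)
    (htrib : ∀ i j k : Fin n, i ≠ j → j ≠ k → k ≠ i →
      ebar i k * e i j + e j i * ebar j k + ebar k j * ebar i k = 0)
    (E : Fin n → Fin n → R) (hE : ∀ i j : Fin n, i ≠ j → E i j = e i j + ebar i j) :
    (∀ i j : Fin n, i ≠ j → E i j * E i j = 0) ∧
    (∀ i j k l : Fin n, i ≠ j → k ≠ l → i ≠ k → i ≠ l → j ≠ k → j ≠ l →
      E i j * E k l + E k l * E i j = 0) ∧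
    (∀ i j k : Fin n, i ≠ j → j ≠ k → k ≠ i →
      E i j * E j k + E j k * E k i + E k i * E i j = 0) := by
  refine ⟨fun i j hij => ?_, fun i j k l hij hkl hik hil hjk hjl => ?_,
    fun i j k hij hjk hki => ?_⟩
  · rw [hE i j hij]
    linear_combination (norm := noncomm_ring) hsq i j hij + hsqb i j hij + hmix i j hij
  · rw [hE i j hij, hE k l hkl]
    linear_combination (norm := noncomm_ring) hdisj i j k l hij hkl hik hil hjk hjl +
      hdisjb i j k l hij hkl hik hil hjk hjl + hdisjbb i j k l hij hkl hik hil hjk hjl +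
      hdisjb k l i j hkl hij hik.symm hjk.symm hil.symm hjl.symm
  · have h₁ := htrib i j k hij hjk hki
    have h₂ := htrib j k i hjk hki hij
    have h₃ := htrib k i j hki hij hjk
    rw [hsymm j i hij.symm, hsymmb i k hki.symm, hsymmb k j hjk.symm] at h₁
    rw [hsymm k j hjk.symm, hsymmb j i hij.symm, hsymmb i k hki.symm] at h₂
    rw [hsymm i k hki.symm, hsymmb k j hjk.symm, hsymmb j i hij.symm] at h₃
    rw [hE i j hij, hE j k hjk, hE k i hki]
    linear_combination (norm := noncomm_ring) htri i j k hij hjk hki + h₁ + h₂ + h₃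
end

section
/- Proposition 5.1. There is a well-defined K-algebra homomorphism ι : Λ_quad(A_{n−1}) → Λ_quad(D_n) sending the class of x(i,j) to the class of y(i,j) + ȳ(i,j), and a well-defined K-algebra homomorphism π : Λ_quad(D_n) → Λ_quad(A_{n−1}) sending the class of y(i,j) to the class of x(i,j) and the class of ȳ(i,j) to 0; these satisfy π ∘ ι = id. In particular, ι is injective, so the elements E(i,j) := y(i,j) + ȳ(i,j) generate a subalgebra of Λ_quad(D_n) isomorphic to Λ_quad(A_{n−1}). -/
/-! Proposition 5.1 of Kirillov–Maeno. We present `Λ_quad(A_{n-1})` and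
`Λ_quad(D_n)` as quotients (via `RingQuot`) of free associative `K`-algebras.
Generators are indexed by ordered pairs of distinct indices, and the relation
`x(i,j) = x(j,i)` is imposed, which is equivalent to having one generator per
unordered pair. -/

/-- Ordered pairs of distinct elements of `Fin n`. -/
abbrev KMPairs (n : ℕ) : Type := {p : Fin n × Fin n // p.1 ≠ p.2}

/-- The generator `x(i,j)` of the free algebra underlying `Λ_quad(A_{n-1})`. -/
noncomputable def KMx (K : Type) [Field K] {n : ℕ} (i j : Fin n) (h : i ≠ j) :
    FreeAlgebra K (KMPairs n) :=
  FreeAlgebra.ι K ⟨(i, j), h⟩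

/-- The generator `y(i,j)` of the free algebra underlying `Λ_quad(D_n)`. -/
noncomputable def KMy (K : Type) [Field K] {n : ℕ} (i j : Fin n) (h : i ≠ j) :
    FreeAlgebra K (KMPairs n ⊕ KMPairs n) :=
  FreeAlgebra.ι K (Sum.inl ⟨(i, j), h⟩)

/-- The generator `ȳ(i,j)` of the free algebra underlying `Λ_quad(D_n)`. -/
noncomputable def KMyb (K : Type) [Field K] {n : ℕ} (i j : Fin n) (h : i ≠ j) :
    FreeAlgebra K (KMPairs n ⊕ KMPairs n) :=
  FreeAlgebra.ι K (Sum.inr ⟨(i, j), h⟩)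

/-- The defining relations of the quadratic algebra `Λ_quad(A_{n-1})`. -/
inductive KMRelA (K : Type) [Field K] (n : ℕ) :
    FreeAlgebra K (KMPairs n) → FreeAlgebra K (KMPairs n) → Prop
  | symm (i j : Fin n) (h : i ≠ j) : KMRelA K n (KMx K i j h) (KMx K j i h.symm)
  | sq (i j : Fin n) (h : i ≠ j) : KMRelA K n (KMx K i j h * KMx K i j h) 0
  | disj (a b c d : Fin n) (hab : a ≠ b) (hcd : c ≠ d)
      (hac : a ≠ c) (had : a ≠ d) (hbc : b ≠ c) (hbd : b ≠ d) :
      KMRelA K n (KMx K a b hab * KMx K c d hcd + KMx K c d hcd * KMx K a b hab) 0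
  | tri (a b c : Fin n) (hab : a ≠ b) (hbc : b ≠ c) (hca : c ≠ a) :
      KMRelA K n (KMx K a b hab * KMx K b c hbc + KMx K b c hbc * KMx K c a hca
        + KMx K c a hca * KMx K a b hab) 0

/-- The defining relations of the quadratic algebra `Λ_quad(D_n)`. -/
inductive KMRelD (K : Type) [Field K] (n : ℕ) :
    FreeAlgebra K (KMPairs n ⊕ KMPairs n) → FreeAlgebra K (KMPairs n ⊕ KMPairs n) → Prop
  | ysymm (i j : Fin n) (h : i ≠ j) : KMRelD K n (KMy K i j h) (KMy K j i h.symm)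
  | ybsymm (i j : Fin n) (h : i ≠ j) : KMRelD K n (KMyb K i j h) (KMyb K j i h.symm)
  | ysq (i j : Fin n) (h : i ≠ j) : KMRelD K n (KMy K i j h * KMy K i j h) 0
  | ybsq (i j : Fin n) (h : i ≠ j) : KMRelD K n (KMyb K i j h * KMyb K i j h) 0
  | disjyy (i j k l : Fin n) (hij : i ≠ j) (hkl : k ≠ l)
      (hik : i ≠ k) (hil : i ≠ l) (hjk : j ≠ k) (hjl : j ≠ l) :
      KMRelD K n (KMy K i j hij * KMy K k l hkl + KMy K k l hkl * KMy K i j hij) 0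
  | disjyyb (i j k l : Fin n) (hij : i ≠ j) (hkl : k ≠ l)
      (hik : i ≠ k) (hil : i ≠ l) (hjk : j ≠ k) (hjl : j ≠ l) :
      KMRelD K n (KMy K i j hij * KMyb K k l hkl + KMyb K k l hkl * KMy K i j hij) 0
  | disjybyb (i j k l : Fin n) (hij : i ≠ j) (hkl : k ≠ l)
      (hik : i ≠ k) (hil : i ≠ l) (hjk : j ≠ k) (hjl : j ≠ l) :
      KMRelD K n (KMyb K i j hij * KMyb K k l hkl + KMyb K k l hkl * KMyb K i j hij) 0
  | mix (i j : Fin n) (h : i ≠ j) :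
      KMRelD K n (KMy K i j h * KMyb K i j h + KMyb K i j h * KMy K i j h) 0
  | ytri (i j k : Fin n) (hij : i ≠ j) (hjk : j ≠ k) (hki : k ≠ i) :
      KMRelD K n (KMy K i j hij * KMy K j k hjk + KMy K j k hjk * KMy K k i hki
        + KMy K k i hki * KMy K i j hij) 0
  | ybtri (i j k : Fin n) (hij : i ≠ j) (hjk : j ≠ k) (hki : k ≠ i) :
      KMRelD K n (KMyb K i k (Ne.symm hki) * KMy K i j hij
        + KMy K j i hij.symm * KMyb K j k hjk
        + KMyb K k j hjk.symm * KMyb K i k (Ne.symm hki)) 0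

/-- The homomorphism `Λ_quad(A_{n-1}) → Λ_quad(D_n)` sending `x(i,j)` to `y(i,j) + ȳ(i,j)`. -/
noncomputable def KMι (K : Type) [Field K] (n : ℕ) :
    RingQuot (KMRelA K n) →ₐ[K] RingQuot (KMRelD K n) :=
  RingQuot.liftAlgHom K ⟨FreeAlgebra.lift K fun p =>
    RingQuot.mkAlgHom K (KMRelD K n) (KMy K p.1.1 p.1.2 p.2) +
      RingQuot.mkAlgHom K (KMRelD K n) (KMyb K p.1.1 p.1.2 p.2), by
    have hD : ∀ {u v}, KMRelD K n u v → RingQuot.mkAlgHom K (KMRelD K n) u =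
        RingQuot.mkAlgHom K (KMRelD K n) v := fun h => RingQuot.mkAlgHom_rel K h
    intro u v huv
    cases huv with
    | symm i j h =>
      simp only [KMx, FreeAlgebra.lift_ι_apply]
      rw [hD (.ysymm i j h), hD (.ybsymm i j h)]
    | sq i j h =>
      have h₁ := hD (.ysq i j h)
      have h₂ := hD (.ybsq i j h)
      have h₃ := hD (.mix i j h)
      simp only [KMx, FreeAlgebra.lift_ι_apply, map_add, map_mul, map_zero] at *
      linear_combination (norm := noncomm_ring) h₁ + h₂ + h₃
    | disj a b c d hab hcd hac had hbc hbd =>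
      have h₁ := hD (.disjyy a b c d hab hcd hac had hbc hbd)
      have h₂ := hD (.disjyyb a b c d hab hcd hac had hbc hbd)
      have h₃ := hD (.disjyyb c d a b hcd hab hac.symm hbc.symm had.symm hbd.symm)
      have h₄ := hD (.disjybyb a b c d hab hcd hac had hbc hbd)
      simp only [KMx, FreeAlgebra.lift_ι_apply, map_add, map_mul, map_zero] at *
      linear_combination (norm := noncomm_ring) h₁ + h₂ + h₃ + h₄
    | tri a b c hab hbc hca =>
      have h₁ := hD (.ytri a b c hab hbc hca)
      have h₂ := hD (.ybtri a b c hab hbc hca)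
      have h₃ := hD (.ybtri b c a hbc hca hab)
      have h₄ := hD (.ybtri c a b hca hab hbc)
      simp only [KMx, FreeAlgebra.lift_ι_apply, map_add, map_mul, map_zero] at *
      rw [hD (.ysymm b a hab.symm), hD (.ybsymm a c hca.symm), hD (.ybsymm c b hbc.symm)] at h₂
      rw [hD (.ysymm c b hbc.symm), hD (.ybsymm b a hab.symm), hD (.ybsymm a c hca.symm)] at h₃
      rw [hD (.ysymm a c hca.symm), hD (.ybsymm c b hbc.symm), hD (.ybsymm b a hab.symm)] at h₄
      linear_combination (norm := noncomm_ring) h₁ + h₂ + h₃ + h₄⟩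

theorem KMι_x (K : Type) [Field K] {n : ℕ} (i j : Fin n) (h : i ≠ j) :
    KMι K n (RingQuot.mkAlgHom K (KMRelA K n) (KMx K i j h)) =
      RingQuot.mkAlgHom K (KMRelD K n) (KMy K i j h) +
        RingQuot.mkAlgHom K (KMRelD K n) (KMyb K i j h) := by
  simp only [KMι, RingQuot.liftAlgHom_mkAlgHom_apply, KMx, FreeAlgebra.lift_ι_apply]

/-- The homomorphism `Λ_quad(D_n) → Λ_quad(A_{n-1})` sending `y(i,j)` to `x(i,j)` and
`ȳ(i,j)` to `0`. -/
noncomputable def KMπ (K : Type) [Field K] (n : ℕ) :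
    RingQuot (KMRelD K n) →ₐ[K] RingQuot (KMRelA K n) :=
  RingQuot.liftAlgHom K ⟨FreeAlgebra.lift K (Sum.elim
    (fun p => RingQuot.mkAlgHom K (KMRelA K n) (KMx K p.1.1 p.1.2 p.2)) fun _ => 0), by
    have hA : ∀ {u v}, KMRelA K n u v → RingQuot.mkAlgHom K (KMRelA K n) u =
        RingQuot.mkAlgHom K (KMRelA K n) v := fun h => RingQuot.mkAlgHom_rel K h
    intro u v huv
    cases huv with
    | ysymm i j h => simpa [KMy] using hA (.symm i j h)
    | ysq i j h => simpa [KMy] using hA (.sq i j h)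
    | disjyy i j k l hij hkl hik hil hjk hjl =>
      simpa [KMy] using hA (.disj i j k l hij hkl hik hil hjk hjl)
    | ytri i j k hij hjk hki => simpa [KMy] using hA (.tri i j k hij hjk hki)
    | _ => simp [KMyb]⟩

theorem KMπ_y (K : Type) [Field K] {n : ℕ} (i j : Fin n) (h : i ≠ j) :
    KMπ K n (RingQuot.mkAlgHom K (KMRelD K n) (KMy K i j h)) =
      RingQuot.mkAlgHom K (KMRelA K n) (KMx K i j h) := by
  simp only [KMπ, RingQuot.liftAlgHom_mkAlgHom_apply, KMy, FreeAlgebra.lift_ι_apply, Sum.elim_inl]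

theorem KMπ_yb (K : Type) [Field K] {n : ℕ} (i j : Fin n) (h : i ≠ j) :
    KMπ K n (RingQuot.mkAlgHom K (KMRelD K n) (KMyb K i j h)) = 0 := by
  simp only [KMπ, RingQuot.liftAlgHom_mkAlgHom_apply, KMyb, FreeAlgebra.lift_ι_apply, Sum.elim_inr]

theorem KMπ_comp_KMι (K : Type) [Field K] (n : ℕ) :
    (KMπ K n).comp (KMι K n) = AlgHom.id K (RingQuot (KMRelA K n)) := by
  apply RingQuot.ringQuot_ext'
  apply FreeAlgebra.hom_ext
  funext ⟨⟨i, j⟩, h⟩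
  change KMπ K n (KMι K n (RingQuot.mkAlgHom K (KMRelA K n) (KMx K i j h))) =
    RingQuot.mkAlgHom K (KMRelA K n) (KMx K i j h)
  rw [KMι_x, map_add, KMπ_y, KMπ_yb, add_zero]

/-- Proposition 5.1 of Kirillov–Maeno: there are `K`-algebra homomorphisms
`ι : Λ_quad(A_{n-1}) → Λ_quad(D_n)` with `ι(x(i,j)) = y(i,j) + ȳ(i,j)` and
`π : Λ_quad(D_n) → Λ_quad(A_{n-1})` with `π(y(i,j)) = x(i,j)`, `π(ȳ(i,j)) = 0`,
satisfying `π ∘ ι = id`; in particular `ι` is injective, so the elements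
`E(i,j) = y(i,j) + ȳ(i,j)` generate a subalgebra of `Λ_quad(D_n)` isomorphic
to `Λ_quad(A_{n-1})`. -/
theorem prop51_subalgebra (K : Type) [Field K] [CharZero K] (n : ℕ) (hn : 1 ≤ n) :
    ∃ (ι : RingQuot (KMRelA K n) →ₐ[K] RingQuot (KMRelD K n))
      (π : RingQuot (KMRelD K n) →ₐ[K] RingQuot (KMRelA K n)),
      (∀ (i j : Fin n) (h : i ≠ j),
        ι (RingQuot.mkAlgHom K (KMRelA K n) (KMx K i j h)) =
          RingQuot.mkAlgHom K (KMRelD K n) (KMy K i j h) +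
            RingQuot.mkAlgHom K (KMRelD K n) (KMyb K i j h)) ∧
      (∀ (i j : Fin n) (h : i ≠ j),
        π (RingQuot.mkAlgHom K (KMRelD K n) (KMy K i j h)) =
          RingQuot.mkAlgHom K (KMRelA K n) (KMx K i j h)) ∧
      (∀ (i j : Fin n) (h : i ≠ j),
        π (RingQuot.mkAlgHom K (KMRelD K n) (KMyb K i j h)) = 0) ∧
      π.comp ι = AlgHom.id K (RingQuot (KMRelA K n)) ∧
      Function.Injective ι := by
  exact ⟨KMι K n, KMπ K n, KMι_x K, KMπ_y K, KMπ_yb K, KMπ_comp_KMι K n,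
    Function.LeftInverse.injective (g := KMπ K n) (DFunLike.congr_fun (KMπ_comp_KMι K n))⟩
end

section
/- (Example 3.1, type G_2.) The elements η_1 = −(2e_1 + e_2 + e_3 + e_5 + e_6) and η_2 = −(e_2 + e_3 + 2e_4 + e_5 + e_6) satisfy the anticommutativity relation η_1 η_2 + η_2 η_1 = 0. -/
/-- Example 3.1 of Kirillov–Maeno, type `G_2`: the flat connections
`η₁ = -(2e₁ + e₂ + e₃ + e₅ + e₆)` and `η₂ = -(e₂ + e₃ + 2e₄ + e₅ + e₆)`
anticommute in `Λ_w(G_2)`. -/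
theorem eta_anticomm_G2 (R : Type*) [Ring R] (e₁ e₂ e₃ e₄ e₅ e₆ : R)
    (h1 : e₁ * e₁ = 0) (h2 : e₂ * e₂ = 0) (h3 : e₃ * e₃ = 0)
    (h4 : e₄ * e₄ = 0) (h5 : e₅ * e₅ = 0) (h6 : e₆ * e₆ = 0)
    (h14 : e₁ * e₄ + e₄ * e₁ = 0)
    (h25 : e₂ * e₅ + e₅ * e₂ = 0)
    (h36 : e₃ * e₆ + e₆ * e₃ = 0)
    (h135 : e₁ * e₃ + e₃ * e₅ + e₅ * e₁ = 0)
    (h531 : e₃ * e₁ + e₅ * e₃ + e₁ * e₅ = 0)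
    (h246 : e₂ * e₄ + e₄ * e₆ + e₆ * e₂ = 0)
    (h642 : e₄ * e₂ + e₆ * e₄ + e₂ * e₆ = 0)
    (hhex : e₁ * e₂ + e₂ * e₃ + e₃ * e₄ + e₄ * e₅ + e₅ * e₆ + e₆ * e₁ = 0)
    (hhex' : e₂ * e₁ + e₃ * e₂ + e₄ * e₃ + e₅ * e₄ + e₆ * e₅ + e₁ * e₆ = 0)
    (η₁ η₂ : R)
    (hη₁ : η₁ = -(2 * e₁ + e₂ + e₃ + e₅ + e₆))
    (hη₂ : η₂ = -(e₂ + e₃ + 2 * e₄ + e₅ + e₆)) :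
    η₁ * η₂ + η₂ * η₁ = 0 := by
  subst hη₁ hη₂
  linear_combination (norm := noncomm_ring)
    4 * h14 + 2 * (h2 + h3 + h5 + h6 + h25 + h36 + h135 + h531 + h246 + h642 + hhex + hhex')
end
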